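/- Threshold welfare bound: Let n ≥ 3 agents have nonnegative valuation functions v_1,…,v_n : [0,1]^n → ℝ, each monotone non-decreasing in every coordinate, let s ∈ [0,1]^n, and assume OPT = max_i v_i(s) > 0. Let k* be the minimal index k ∈ ℕ such that N_{k+1} < ∑_{ℓ=0}^{k} N_ℓ (such k* exists since N_0 ≥ 1 and ∑_k N_k ≤ n). Then ∑_{i : v_i(s) > 0} y_i(v,s)·v_i(s) ≥ (1 − 1/log₂ n)^{k*} · OPT / ( 2·(2·log₂ n + 1)·(ln n + 1) ). -/

import Mathlib

open Function

/-- A signal profile: each of the `n` agents has a signal in `[0,1]`. -/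
abbrev Sig (n : ℕ) := Fin n → unitInterval

/-- A valid valuation function: nonnegative and monotone non-decreasing in each coordinate. -/
def ValidVal {n : ℕ} (v : Sig n → ℝ) : Prop :=
  (∀ s, 0 ≤ v s) ∧ Monotone v

/-- `log₂ n` as a real number. -/
noncomputable def lgn (n : ℕ) : ℝ := Real.logb 2 (n : ℝ)

/-- The set `D_i(v,s)` of agents `j ≠ i` with `v_j(1_i, s_{-i}) ≥ v_i(s)` and
`v_j(0_i, s_{-i}) ≥ (1 − 1/log₂ n)·v_i(s)`. -/
def Dset (n : ℕ) (v : Fin n → Sig n → ℝ) (s : Sig n) (i : Fin n) : Set (Fin n) :=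
  {j | j ≠ i ∧ v i s ≤ v j (Function.update s i 1) ∧
    (1 - 1 / lgn n) * v i s ≤ v j (Function.update s i 0)}

/-- The allocation probability `x_i(v,s) = 1/((2·log₂ n + 1)·(ln n + 1)·(|D_i(v,s)| + 1))`. -/
noncomputable def xalloc (n : ℕ) (v : Fin n → Sig n → ℝ) (s : Sig n) (i : Fin n) : ℝ :=
  1 / ((2 * lgn n + 1) * (Real.log (n : ℝ) + 1) * (((Dset n v s i).ncard : ℝ) + 1))

/-- The threshold `T_ℓ = (1 − 1/log₂ n)^ℓ · OPT`. -/
noncomputable def Tlev (n : ℕ) (OPT : ℝ) (ℓ : ℕ) : ℝ := (1 - 1 / lgn n) ^ ℓ * OPT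

/-- `ℓ(i)`: the minimal level `ℓ` such that `v_i(s) ≥ T_ℓ`. -/
noncomputable def lev (n : ℕ) (v : Fin n → Sig n → ℝ) (s : Sig n) (OPT : ℝ) (i : Fin n) : ℕ :=
  sInf {m : ℕ | Tlev n OPT m ≤ v i s}

/-- The set `E_i(v,s)` of agents `j ≠ i` with `v_j(1_i, s_{-i}) ≥ T_{ℓ(i)}` and
`v_j(0_i, s_{-i}) ≥ T_{ℓ(i)+1}`. -/
def Eset (n : ℕ) (v : Fin n → Sig n → ℝ) (s : Sig n) (OPT : ℝ) (i : Fin n) : Set (Fin n) :=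
  {j | j ≠ i ∧ Tlev n OPT (lev n v s OPT i) ≤ v j (Function.update s i 1) ∧
    Tlev n OPT (lev n v s OPT i + 1) ≤ v j (Function.update s i 0)}

/-- `y_i(v,s) = 1/((2·log₂ n + 1)·(ln n + 1)·(|E_i(v,s)| + 1))`. -/
noncomputable def yalloc (n : ℕ) (v : Fin n → Sig n → ℝ) (s : Sig n) (OPT : ℝ) (i : Fin n) : ℝ :=
  1 / ((2 * lgn n + 1) * (Real.log (n : ℝ) + 1) * (((Eset n v s OPT i).ncard : ℝ) + 1))

/-- `N_0` is the number of agents with `v_j(s) ≥ T_0`; for `k ≥ 1`, `N_k` is the number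
of agents with `T_k ≤ v_j(s) < T_{k-1}`. -/
noncomputable def Nlevel (n : ℕ) (v : Fin n → Sig n → ℝ) (s : Sig n) (OPT : ℝ) : ℕ → ℕ
  | 0 => ({j : Fin n | Tlev n OPT 0 ≤ v j s}).ncard
  | (k+1) => ({j : Fin n | Tlev n OPT (k+1) ≤ v j s ∧ v j s < Tlev n OPT k}).ncard

theorem aux_lgn (n : ℕ) (hn : 3 ≤ n) : 1 < lgn n := by
  unfold lgn
  rw [Real.lt_logb_iff_rpow_lt (by norm_num) (by positivity)]
  have : (3 : ℝ) ≤ n := by exact_mod_cast hn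
  norm_num
  linarith

theorem aux_r (n : ℕ) (hn : 3 ≤ n) : 0 < 1 - 1 / lgn n ∧ 1 - 1 / lgn n ≤ 1 := by
  have h := aux_lgn n hn
  have h1 : 1 / lgn n < 1 := by rw [div_lt_one (by linarith)]; exact h
  have h2 : 0 < 1 / lgn n := by positivity
  constructor <;> linarith

theorem aux_T_anti (n : ℕ) (hn : 3 ≤ n) (OPT : ℝ) (hpos : 0 < OPT) : Antitone (Tlev n OPT) := by
  intro a b hab
  unfold Tlev
  have := aux_r n hn
  exact mul_le_mul_of_nonneg_right (pow_le_pow_of_le_one this.1.le this.2 hab) hpos.le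

theorem aux_T_pos (n : ℕ) (hn : 3 ≤ n) (OPT : ℝ) (hpos : 0 < OPT) (k : ℕ) : 0 < Tlev n OPT k := by
  unfold Tlev
  have := (aux_r n hn).1
  positivity

open Classical in
noncomputable def Lset (n : ℕ) (v : Fin n → Sig n → ℝ) (s : Sig n) (OPT : ℝ) (k : ℕ) :
    Finset (Fin n) :=
  Finset.univ.filter (fun j => Tlev n OPT k ≤ v j s ∧ ∀ m < k, v j s < Tlev n OPT m)

open Classical in
noncomputable def Uset (n : ℕ) (v : Fin n → Sig n → ℝ) (s : Sig n) (OPT : ℝ) (k : ℕ) :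
    Finset (Fin n) :=
  Finset.univ.filter (fun j => Tlev n OPT k ≤ v j s)

theorem aux_N (n : ℕ) (hn : 3 ≤ n) (v : Fin n → Sig n → ℝ) (s : Sig n) (OPT : ℝ) (hpos : 0 < OPT)
    (k : ℕ) : Nlevel n v s OPT k = (Lset n v s OPT k).card := by
  rw [← Set.ncard_coe_finset]
  cases k with
  | zero => simp [Nlevel, Lset]
  | succ k =>
    unfold Nlevel
    refine congrArg Set.ncard ?_
    ext j
    simp only [Lset, Set.mem_ofPred_eq, Finset.coe_filter, Finset.mem_univ, true_and]
    refine and_congr_right fun _ => ⟨fun h m hm => ?_, fun h => h k (by omega)⟩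
    exact h.trans_le (aux_T_anti n hn OPT hpos (by omega))

theorem aux_S (n : ℕ) (hn : 3 ≤ n) (v : Fin n → Sig n → ℝ) (s : Sig n) (OPT : ℝ) (hpos : 0 < OPT)
    (k : ℕ) : ∑ l ∈ Finset.range (k + 1), Nlevel n v s OPT l = (Uset n v s OPT k).card := by
  classical
  induction k with
  | zero => simp [aux_N n hn v s OPT hpos, Lset, Uset]
  | succ k ih =>
    rw [Finset.sum_range_succ, ih, aux_N n hn v s OPT hpos, ← Finset.card_union_of_disjoint]
    · congr 1
      ext j
      simp only [Lset, Uset, Finset.mem_union, Finset.mem_filter, Finset.mem_univ, true_and]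
      constructor
      · rintro (h | h)
        · exact (aux_T_anti n hn OPT hpos (by omega)).trans h
        · exact h.1
      · intro h
        by_cases h' : Tlev n OPT k ≤ v j s
        · exact Or.inl h'
        · right
          refine ⟨h, fun m hm => (not_le.1 h').trans_le (aux_T_anti n hn OPT hpos (by omega))⟩
    · rw [Finset.disjoint_left]
      intro j h1 h2
      simp only [Lset, Uset, Finset.mem_filter, Finset.mem_univ, true_and] at h1 h2
      exact absurd h1 (not_le.2 (h2.2 k (by omega)))

theorem aux_term (n : ℕ) (hn : 3 ≤ n) (v : Fin n → Sig n → ℝ) (hval : ∀ j, ValidVal (v j))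
    (s : Sig n) (OPT : ℝ) (hpos : 0 < OPT) (k : ℕ) (i : Fin n) (hi : i ∈ Lset n v s OPT k) :
    Tlev n OPT k / ((2 * lgn n + 1) * (Real.log (n : ℝ) + 1) * ((Uset n v s OPT (k+1)).card : ℝ)) ≤
      yalloc n v s OPT i * v i s := by
  classical
  have hl := aux_lgn n hn
  have hlog : 0 ≤ Real.log (n : ℝ) := Real.log_natCast_nonneg n
  simp only [Lset, Finset.mem_filter, Finset.mem_univ, true_and] at hi
  have hlev : lev n v s OPT i = k := by
    unfold lev
    apply le_antisymm
    · exact Nat.sInf_le hi.1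
    · apply le_csInf ⟨k, hi.1⟩
      intro m hm
      by_contra hlt
      exact absurd (hi.2 m (not_le.1 hlt)) (not_lt.2 hm)
  have hcard : (Eset n v s OPT i).ncard + 1 ≤ (Uset n v s OPT (k+1)).card := by
    have hnot : i ∉ Eset n v s OPT i := fun h => h.1 rfl
    rw [← Set.ncard_insert_of_notMem hnot (Set.toFinite _), ← Set.ncard_coe_finset]
    apply Set.ncard_le_ncard _ (Set.toFinite _)
    intro j hj
    simp only [Uset, Finset.coe_filter, Finset.mem_univ, true_and, Set.mem_ofPred_eq]
    rcases hj with rfl | hj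
    · exact (aux_T_anti n hn OPT hpos (by omega)).trans hi.1
    · have := hj.2.2
      rw [hlev] at this
      refine this.trans ((hval j).2 ?_)
      exact update_le_self_iff.2 unitInterval.nonneg'
  have hcard' : ((Eset n v s OPT i).ncard : ℝ) + 1 ≤ ((Uset n v s OPT (k+1)).card : ℝ) := by
    exact_mod_cast hcard
  have hT := aux_T_pos n hn OPT hpos k
  unfold yalloc
  rw [one_div_mul_eq_div]
  have := hi.1
  have := (hval i).1 s
  gcongr

theorem aux_blk (n : ℕ) (hn : 3 ≤ n) (v : Fin n → Sig n → ℝ) (hval : ∀ j, ValidVal (v j))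
    (s : Sig n) (OPT : ℝ) (hpos : 0 < OPT) (k : ℕ) :
    (Nlevel n v s OPT k : ℝ) * (Tlev n OPT k /
      ((2 * lgn n + 1) * (Real.log (n : ℝ) + 1) * ((Uset n v s OPT (k+1)).card : ℝ))) ≤
      ∑ i ∈ Lset n v s OPT k, yalloc n v s OPT i * v i s := by
  rw [aux_N n hn v s OPT hpos, ← nsmul_eq_mul]
  exact Finset.card_nsmul_le_sum _ _ _ (aux_term n hn v hval s OPT hpos k)

open Classical in
/-- threshold welfare bound.  If `k*` is the minimal index `k` with
`N_{k+1} < ∑_{ℓ=0}^k N_ℓ`, then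
`∑_{i : v_i(s) > 0} y_i(v,s)·v_i(s) ≥ (1 − 1/log₂ n)^{k*} · OPT / (2·(2·log₂ n + 1)·(ln n + 1))`. -/
theorem stmt12 (n : ℕ) (hn : 3 ≤ n)
    (v : Fin n → Sig n → ℝ) (hval : ∀ j, ValidVal (v j)) (s : Sig n)
    (OPT : ℝ) (hOPT : IsGreatest (Set.range fun i => v i s) OPT) (hpos : 0 < OPT)
    (kstar : ℕ)
    (hks : Nlevel n v s OPT (kstar + 1) < ∑ ℓ ∈ Finset.range (kstar + 1), Nlevel n v s OPT ℓ)
    (hksmin : ∀ m < kstar,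
      ¬ (Nlevel n v s OPT (m + 1) < ∑ ℓ ∈ Finset.range (m + 1), Nlevel n v s OPT ℓ)) :
    (1 - 1 / lgn n) ^ kstar * OPT / (2 * (2 * lgn n + 1) * (Real.log (n : ℝ) + 1)) ≤
      ∑ i ∈ Finset.univ.filter (fun i : Fin n => 0 < v i s),
        yalloc n v s OPT i * v i s := by
  have hl := aux_lgn n hn
  have hlog : 0 ≤ Real.log (n : ℝ) := Real.log_natCast_nonneg n
  have hnn : ∀ i, 0 ≤ yalloc n v s OPT i * v i s := by
    intro i
    apply mul_nonneg _ ((hval i).1 s)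
    unfold yalloc
    positivity
  have hsub : ∀ k, Lset n v s OPT k ⊆ Finset.univ.filter (fun i : Fin n => 0 < v i s) := by
    intro k i hi
    simp only [Lset, Finset.mem_filter, Finset.mem_univ, true_and] at hi ⊢
    exact (aux_T_pos n hn OPT hpos k).trans_le hi.1
  have hS := aux_S n hn v s OPT hpos
  have hSs : ∀ k, (Uset n v s OPT (k+1)).card =
      (Uset n v s OPT k).card + Nlevel n v s OPT (k+1) := by
    intro k
    rw [← hS, ← hS, Finset.sum_range_succ]
  have hS0 : (Uset n v s OPT 0).card = Nlevel n v s OPT 0 := by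
    rw [← hS]; simp
  simp only [hS] at hks hksmin
  set C := (2 * lgn n + 1) * (Real.log (n : ℝ) + 1) with hC
  have hCpos : 0 < C := by positivity
  have hgoal : (1 - 1 / lgn n) ^ kstar * OPT / (2 * (2 * lgn n + 1) * (Real.log (n : ℝ) + 1))
      = Tlev n OPT kstar / (2 * C) := by
    rw [hC, ← mul_assoc]; rfl
  rw [hgoal]
  have hblk := aux_blk n hn v hval s OPT hpos
  simp only [← hC] at hblk
  have hTp := aux_T_pos n hn OPT hpos kstar
  -- level `kstar` terms
  have hA : (Nlevel n v s OPT kstar : ℝ) *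
      (Tlev n OPT kstar / (C * (2 * (Uset n v s OPT kstar).card))) ≤
      ∑ i ∈ Lset n v s OPT kstar, yalloc n v s OPT i * v i s := by
    refine le_trans ?_ (hblk kstar)
    have h1 : ((Uset n v s OPT (kstar+1)).card : ℝ) ≤ 2 * (Uset n v s OPT kstar).card := by
      have := hSs kstar
      exact_mod_cast (by omega : (Uset n v s OPT (kstar+1)).card ≤ 2 * (Uset n v s OPT kstar).card)
    have h2 : (0 : ℝ) < (Uset n v s OPT (kstar+1)).card := by
      have := hSs kstar
      exact_mod_cast (by omega : 0 < (Uset n v s OPT (kstar+1)).card)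
    gcongr
  have hUpos : (0 : ℝ) < (Uset n v s OPT kstar).card := by
    exact_mod_cast (by omega : 0 < (Uset n v s OPT kstar).card)
  cases kstar with
  | zero =>
    refine le_trans ?_ (hA.trans (Finset.sum_le_sum_of_subset_of_nonneg (hsub 0)
      fun i _ _ => hnn i))
    rw [← hS0]
    apply le_of_eq
    field_simp
  | succ K =>
    have hdisj : Disjoint (Lset n v s OPT K) (Lset n v s OPT (K+1)) := by
      rw [Finset.disjoint_left]
      intro j h1 h2
      simp only [Lset, Finset.mem_filter, Finset.mem_univ, true_and] at h1 h2
      exact absurd h1.1 (not_le.2 (h2.2 K (by omega)))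
    refine le_trans ?_ (Finset.sum_le_sum_of_subset_of_nonneg
      (Finset.union_subset (hsub K) (hsub (K+1))) fun i _ _ => hnn i)
    rw [Finset.sum_union hdisj]
    refine le_trans ?_ (add_le_add (hblk K) hA)
    have hTT : Tlev n OPT (K+1) ≤ Tlev n OPT K := aux_T_anti n hn OPT hpos (by omega)
    have h2N : (Uset n v s OPT K).card ≤ 2 * Nlevel n v s OPT K := by
      cases K with
      | zero => omega
      | succ J =>
        have := hksmin J (by omega)
        have := hSs J
        omega
    have hc : (Uset n v s OPT (K+1)).card ≤ 2 * Nlevel n v s OPT K + Nlevel n v s OPT (K+1) := by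
      have := hSs K
      omega
    have hc' : ((Uset n v s OPT (K+1)).card : ℝ) ≤
        2 * Nlevel n v s OPT K + Nlevel n v s OPT (K+1) := by exact_mod_cast hc
    set U : ℝ := ((Uset n v s OPT (K+1)).card : ℝ)
    set T := Tlev n OPT (K+1)
    calc T / (2 * C) = U * (T / (C * (2 * U))) := by field_simp
      _ ≤ (2 * Nlevel n v s OPT K + Nlevel n v s OPT (K+1)) * (T / (C * (2 * U))) := by gcongr
      _ = Nlevel n v s OPT K * (T / (C * U)) + Nlevel n v s OPT (K+1) * (T / (C * (2 * U))) := by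
        field_simp
      _ ≤ _ := by gcongr
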